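/- For every simplicial monoid M, the data W_mon M — with (W_mon M)_n = M_n × M_{n-1} × ... × M_0 equipped with the componentwise monoid structure, faces d_0(m_n,...,m_0) = (m_{n-1},...,m_0) and d_i(m_n,...,m_0) = (d_i m_n, d_{i-1} m_{n-1}, ..., d_1 m_{n-i+1}, m_{n-i-1}, ..., m_0) for i > 0, and degeneracies s_i(m_n,...,m_0) = (s_i m_n, ..., s_0 m_{n-i}, m_{n-i}, m_{n-i-1}, ..., m_0) — is a simplicial monoid, and the assignment M ↦ W_mon M, together with the unit ι_M : m ↦ (m, d_0 m, ..., d_0^n m) and multiplication μ_M given levelwise by the product of first-factor projections, is a monad on the category of simplicial monoids. -/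

import Mathlib

universe u

/-- The data of a simplicial monoid: a monoid `X n` for each `n`, with face maps
`d n i : X (n+1) → X n` (meaningful for `i ≤ n+1`) and degeneracy maps
`s n i : X n → X (n+1)` (meaningful for `i ≤ n`). -/
structure SMonData where
  X : ℕ → Type u
  mon : ∀ n, Monoid (X n)
  d : ∀ n, ℕ → X (n+1) → X n
  s : ∀ n, ℕ → X n → X (n+1)

attribute [instance] SMonData.mon

/-- A simplicial monoid: the data satisfies the simplicial identities and all face and
degeneracy maps are monoid homomorphisms. -/
structure SMon extends SMonData where
  d_mul : ∀ n i (x y : X (n+1)), d n i (x * y) = d n i x * d n i y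
  d_one : ∀ n i, d n i (1 : X (n+1)) = 1
  s_mul : ∀ n i (x y : X n), s n i (x * y) = s n i x * s n i y
  s_one : ∀ n i, s n i (1 : X n) = 1
  d_d : ∀ n i j, i < j → j ≤ n + 2 → ∀ x : X (n+2),
    d n i (d (n+1) j x) = d n (j-1) (d (n+1) i x)
  s_s : ∀ n i j, i ≤ j → j ≤ n → ∀ x : X n,
    s (n+1) i (s n j x) = s (n+1) (j+1) (s n i x)
  d_s_lt : ∀ n i j, i < j → j ≤ n + 1 → ∀ x : X (n+1),
    d (n+1) i (s (n+1) j x) = s n (j-1) (d n i x)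
  d_s_self : ∀ n j, j ≤ n → ∀ x : X n, d n j (s n j x) = x
  d_s_succ : ∀ n j, j ≤ n → ∀ x : X n, d n (j+1) (s n j x) = x
  d_s_gt : ∀ n i j, j + 1 < i → i ≤ n + 2 → ∀ x : X (n+1),
    d (n+1) i (s (n+1) j x) = s n j (d n (i-1) x)

/-- The underlying family of the W-construction: `WObj M n = M_n × M_{n-1} × ⋯ × M_0`. -/
def WObj (M : SMonData.{u}) : ℕ → Type u
  | 0 => M.X 0
  | n+1 => M.X (n+1) × WObj M n

/-- Componentwise monoid structure on `WObj M n`. -/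
instance WMonoid (M : SMonData.{u}) : ∀ n, Monoid (WObj M n)
  | 0 => M.mon 0
  | n+1 => @Prod.instMonoid _ _ (M.mon (n+1)) (WMonoid M n)

/-- Face maps of `W_mon M`:
`d_0(m_n,…,m_0) = (m_{n-1},…,m_0)` and
`d_i(m_n,…,m_0) = (d_i m_n, …, d_1 m_{n-i+1}, m_{n-i-1}, …, m_0)` for `i > 0`. -/
def Wd (M : SMonData.{u}) : ∀ n, ℕ → WObj M (n+1) → WObj M n
  | _, 0, x => x.2
  | 0, i+1, x => M.d 0 (i+1) x.1
  | n+1, i+1, x => (M.d (n+1) (i+1) x.1, Wd M n i x.2)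

/-- Degeneracy maps of `W_mon M`:
`s_i(m_n,…,m_0) = (s_i m_n, …, s_0 m_{n-i}, m_{n-i}, m_{n-i-1}, …, m_0)`. -/
def Ws (M : SMonData.{u}) : ∀ n, ℕ → WObj M n → WObj M (n+1)
  | 0, _, x => (M.s 0 0 x, x)
  | n+1, 0, x => (M.s (n+1) 0 x.1, x)
  | n+1, i+1, x => (M.s (n+1) (i+1) x.1, Ws M n i x.2)

/-- The simplicial-monoid data of `W_mon M`. -/
def WmonData (M : SMonData.{u}) : SMonData.{u} where
  X := WObj M
  mon := WMonoid M
  d := Wd M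
  s := Ws M

/-- Levelwise application of a family of maps to the W-construction (`W_mon` on morphisms). -/
def Wmap (M N : SMonData.{u}) (f : ∀ n, M.X n → N.X n) : ∀ n, WObj M n → WObj N n
  | 0, x => f 0 x
  | n+1, x => (f (n+1) x.1, Wmap M N f n x.2)

/-- First-factor projection `(W_mon M)_n = M_n × ⋯ × M_0 → M_n`. -/
def Wfst (M : SMonData.{u}) : ∀ n, WObj M n → M.X n
  | 0, x => x
  | _+1, x => x.1

/-- The unit `ι_M : M → W_mon M`, `m ↦ (m, d_0 m, d_0² m, …, d_0ⁿ m)`. -/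
def Wiota (M : SMonData.{u}) : ∀ n, M.X n → WObj M n
  | 0, m => m
  | n+1, m => (m, Wiota M n (M.d n 0 m))

/-- The multiplication `μ_M : W_mon (W_mon M) → W_mon M`, levelwise the product of the
first-factor projections. -/
def Wmu (M : SMonData.{u}) : ∀ n, WObj (WmonData M) n → WObj M n :=
  Wmap (WmonData M) M (fun n => Wfst M n)

/-- `f` is a morphism of simplicial monoids `M → N`: levelwise a monoid homomorphism,
commuting with all face and degeneracy maps. -/
def IsSMonMor (M N : SMonData.{u}) (f : ∀ n, M.X n → N.X n) : Prop :=
  (∀ n (x y : M.X n), f n (x * y) = f n x * f n y) ∧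
  (∀ n, f n (1 : M.X n) = 1) ∧
  (∀ n i, i ≤ n + 1 → ∀ x : M.X (n+1), f n (M.d n i x) = N.d n i (f (n+1) x)) ∧
  (∀ n i, i ≤ n → ∀ x : M.X n, f (n+1) (M.s n i x) = N.s n i (f n x))

/-- The property of being a simplicial monoid: all simplicial identities hold and all face
and degeneracy maps are monoid homomorphisms. -/
def IsSimplicialMonoid (D : SMonData.{u}) : Prop :=
  (∀ n i (x y : D.X (n+1)), D.d n i (x * y) = D.d n i x * D.d n i y) ∧
  (∀ n i, D.d n i (1 : D.X (n+1)) = 1) ∧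
  (∀ n i (x y : D.X n), D.s n i (x * y) = D.s n i x * D.s n i y) ∧
  (∀ n i, D.s n i (1 : D.X n) = 1) ∧
  (∀ n i j, i < j → j ≤ n + 2 → ∀ x : D.X (n+2),
    D.d n i (D.d (n+1) j x) = D.d n (j-1) (D.d (n+1) i x)) ∧
  (∀ n i j, i ≤ j → j ≤ n → ∀ x : D.X n,
    D.s (n+1) i (D.s n j x) = D.s (n+1) (j+1) (D.s n i x)) ∧
  (∀ n i j, i < j → j ≤ n + 1 → ∀ x : D.X (n+1),
    D.d (n+1) i (D.s (n+1) j x) = D.s n (j-1) (D.d n i x)) ∧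
  (∀ n j, j ≤ n → ∀ x : D.X n, D.d n j (D.s n j x) = x) ∧
  (∀ n j, j ≤ n → ∀ x : D.X n, D.d n (j+1) (D.s n j x) = x) ∧
  (∀ n i j, j + 1 < i → i ≤ n + 2 → ∀ x : D.X (n+1),
    D.d (n+1) i (D.s (n+1) j x) = D.s n j (D.d n (i-1) x))

theorem IsSimplicialMonoid.exists_toSMonData_eq {D : SMonData.{u}} (h : IsSimplicialMonoid D) :
    ∃ H : SMon.{u}, H.toSMonData = D := by
  obtain ⟨dm, d1, sm, s1, dd, ss, dsl, ds0, ds1, dsg⟩ := h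
  exact ⟨{ D with
    d_mul := dm, d_one := d1, s_mul := sm, s_one := s1, d_d := dd, s_s := ss,
    d_s_lt := dsl, d_s_self := ds0, d_s_succ := ds1, d_s_gt := dsg }, rfl⟩

theorem Wd_zero (M : SMonData.{u}) : ∀ n (x : WObj M (n+1)), Wd M n 0 x = x.2
  | 0, _ => rfl
  | _+1, _ => rfl

section Identities

variable (M : SMon.{u})

theorem Wd_mul : ∀ n i (x y : WObj M.toSMonData (n+1)),
    Wd M.toSMonData n i (x * y) = Wd M.toSMonData n i x * Wd M.toSMonData n i y
  | _, 0, _, _ => by simp only [Wd_zero]; rfl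
  | 0, i+1, x, y => M.d_mul 0 (i+1) x.1 y.1
  | n+1, i+1, x, y => Prod.ext (M.d_mul (n+1) (i+1) x.1 y.1) (Wd_mul n i x.2 y.2)

theorem Wd_one : ∀ n i, Wd M.toSMonData n i (1 : WObj M.toSMonData (n+1)) = 1
  | n, 0 => Wd_zero _ n 1
  | 0, i+1 => M.d_one 0 (i+1)
  | n+1, i+1 => Prod.ext (M.d_one (n+1) (i+1)) (Wd_one n i)

theorem Ws_mul : ∀ n i (x y : WObj M.toSMonData n),
    Ws M.toSMonData n i (x * y) = Ws M.toSMonData n i x * Ws M.toSMonData n i y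
  | 0, _, x, y => Prod.ext (M.s_mul 0 0 x y) rfl
  | n+1, 0, x, y => Prod.ext (M.s_mul (n+1) 0 x.1 y.1) rfl
  | n+1, i+1, x, y => Prod.ext (M.s_mul (n+1) (i+1) x.1 y.1) (Ws_mul n i x.2 y.2)

theorem Ws_one : ∀ n i, Ws M.toSMonData n i (1 : WObj M.toSMonData n) = 1
  | 0, _ => Prod.ext (M.s_one 0 0) rfl
  | n+1, 0 => Prod.ext (M.s_one (n+1) 0) rfl
  | n+1, i+1 => Prod.ext (M.s_one (n+1) (i+1)) (Ws_one n i)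

theorem Wd_Wd : ∀ n i j, i < j → j ≤ n + 2 → ∀ x : WObj M.toSMonData (n+2),
    Wd M.toSMonData n i (Wd M.toSMonData (n+1) j x) =
      Wd M.toSMonData n (j-1) (Wd M.toSMonData (n+1) i x)
  | _, 0, _+1, _, _, _ => by simp only [Wd_zero]; rfl
  | 0, i+1, j+2, h, hj, x => M.d_d 0 (i+1) (j+2) h hj x.1
  | n+1, i+1, j+2, h, hj, x =>
    Prod.ext (M.d_d (n+1) (i+1) (j+2) h hj x.1)
      (Wd_Wd n i (j+1) (by omega) (by omega) x.2)

theorem Ws_Ws : ∀ n i j, i ≤ j → j ≤ n → ∀ x : WObj M.toSMonData n,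
    Ws M.toSMonData (n+1) i (Ws M.toSMonData n j x) =
      Ws M.toSMonData (n+1) (j+1) (Ws M.toSMonData n i x)
  | 0, 0, 0, h, hj, x => Prod.ext (M.s_s 0 0 0 h hj x) rfl
  | n+1, 0, 0, h, hj, x => Prod.ext (M.s_s (n+1) 0 0 h hj x.1) rfl
  | n+1, 0, j+1, h, hj, x => Prod.ext (M.s_s (n+1) 0 (j+1) h hj x.1) rfl
  | 0, 0, _+1, _, hj, _ => absurd hj (by omega)
  | 0, _+1, _, h, hj, _ => absurd (h.trans hj) (by omega)
  | n+1, i+1, j+1, h, hj, x =>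
    Prod.ext (M.s_s (n+1) (i+1) (j+1) h hj x.1)
      (Ws_Ws n i j (by omega) (by omega) x.2)

theorem Wd_Ws_of_lt : ∀ n i j, i < j → j ≤ n + 1 → ∀ x : WObj M.toSMonData (n+1),
    Wd M.toSMonData (n+1) i (Ws M.toSMonData (n+1) j x) =
      Ws M.toSMonData n (j-1) (Wd M.toSMonData n i x)
  | _, 0, _+1, _, _, _ => by simp only [Wd_zero]; rfl
  | 0, _+1, _+2, _, hj, _ => absurd hj (by omega)
  | n+1, i+1, j+2, h, hj, x =>
    Prod.ext (M.d_s_lt (n+1) (i+1) (j+2) h hj x.1)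
      (Wd_Ws_of_lt n i (j+1) (by omega) (by omega) x.2)

theorem Wd_Ws_self : ∀ n j, j ≤ n → ∀ x : WObj M.toSMonData n,
    Wd M.toSMonData n j (Ws M.toSMonData n j x) = x
  | 0, 0, _, _ => rfl
  | _+1, 0, _, _ => rfl
  | n+1, j+1, h, x =>
    Prod.ext (M.d_s_self (n+1) (j+1) h x.1) (Wd_Ws_self n j (by omega) x.2)

theorem Wd_Ws_succ : ∀ n j, j ≤ n → ∀ x : WObj M.toSMonData n,
    Wd M.toSMonData n (j+1) (Ws M.toSMonData n j x) = x
  | 0, 0, h, x => M.d_s_succ 0 0 h x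
  | n+1, 0, h, x => Prod.ext (M.d_s_succ (n+1) 0 h x.1) (Wd_zero _ n _)
  | n+1, j+1, h, x =>
    Prod.ext (M.d_s_succ (n+1) (j+1) h x.1) (Wd_Ws_succ n j (by omega) x.2)

theorem Wd_Ws_of_gt : ∀ n i j, j + 1 < i → i ≤ n + 2 → ∀ x : WObj M.toSMonData (n+1),
    Wd M.toSMonData (n+1) i (Ws M.toSMonData (n+1) j x) =
      Ws M.toSMonData n j (Wd M.toSMonData n (i-1) x)
  | 0, i+2, 0, h, hi, x => Prod.ext (M.d_s_gt 0 (i+2) 0 h hi x.1) rfl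
  | n+1, i+2, 0, h, hi, x => Prod.ext (M.d_s_gt (n+1) (i+2) 0 h hi x.1) rfl
  | 0, _+2, _+1, _, _, _ => by omega
  | n+1, i+2, j+1, h, hi, x =>
    Prod.ext (M.d_s_gt (n+1) (i+2) (j+1) h hi x.1)
      (Wd_Ws_of_gt n (i+1) j (by omega) (by omega) x.2)

theorem isSimplicialMonoid_WmonData : IsSimplicialMonoid (WmonData M.toSMonData) :=
  ⟨Wd_mul M, Wd_one M, Ws_mul M, Ws_one M, Wd_Wd M, Ws_Ws M, Wd_Ws_of_lt M, Wd_Ws_self M,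
    Wd_Ws_succ M, Wd_Ws_of_gt M⟩

end Identities

/-- `Wmap f` is a morphism as soon as `f` is compatible with all structure maps except possibly
the faces `d_0`, which do not occur in the structure maps of the W-construction. -/
theorem isSMonMor_Wmap {M N : SMonData.{u}} {f : ∀ n, M.X n → N.X n}
    (hmul : ∀ n (x y : M.X n), f n (x * y) = f n x * f n y)
    (hone : ∀ n, f n (1 : M.X n) = 1)
    (hd : ∀ n i, i ≤ n → ∀ x : M.X (n+1), f n (M.d n (i+1) x) = N.d n (i+1) (f (n+1) x))
    (hs : ∀ n i, i ≤ n → ∀ x : M.X n, f (n+1) (M.s n i x) = N.s n i (f n x)) :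
    IsSMonMor (WmonData M) (WmonData N) (Wmap M N f) := by
  refine ⟨fun n => ?_, fun n => ?_, fun n => ?_, fun n => ?_⟩
  · induction n with
    | zero => exact hmul 0
    | succ n ih => exact fun x y => Prod.ext (hmul (n+1) x.1 y.1) (ih x.2 y.2)
  · induction n with
    | zero => exact hone 0
    | succ n ih => exact Prod.ext (hone (n+1)) ih
  · induction n with
    | zero =>
      rintro (_ | i) h x
      · rfl
      · exact hd 0 i (by omega) x.1
    | succ n ih =>
      rintro (_ | i) h x
      · rfl
      · exact Prod.ext (hd (n+1) i (by omega) x.1) (ih i (by omega) x.2)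
  · induction n with
    | zero => exact fun i _ x => Prod.ext (hs 0 0 le_rfl x) rfl
    | succ n ih =>
      rintro (_ | i) h x
      · exact Prod.ext (hs (n+1) 0 h x.1) rfl
      · exact Prod.ext (hs (n+1) (i+1) h x.1) (ih i (by omega) x.2)

theorem Wmap_id (M : SMonData.{u}) : ∀ n (x : WObj M n), Wmap M M (fun _ m => m) n x = x
  | 0, _ => rfl
  | n+1, x => Prod.ext rfl (Wmap_id M n x.2)

theorem Wmap_comp (M N P : SMonData.{u}) (f : ∀ n, M.X n → N.X n) (g : ∀ n, N.X n → P.X n) :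
    ∀ n x, Wmap M P (fun m y => g m (f m y)) n x = Wmap N P g n (Wmap M N f n x)
  | 0, _ => rfl
  | n+1, x => Prod.ext rfl (Wmap_comp M N P f g n x.2)

theorem isSMonMor_Wiota (M : SMon.{u}) :
    IsSMonMor M.toSMonData (WmonData M.toSMonData) (Wiota M.toSMonData) := by
  refine ⟨fun n => ?_, fun n => ?_, fun n => ?_, fun n => ?_⟩
  · induction n with
    | zero => exact fun _ _ => rfl
    | succ n ih =>
      exact fun x y => Prod.ext rfl ((congrArg _ (M.d_mul n 0 x y)).trans (ih _ _))
  · induction n with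
    | zero => rfl
    | succ n ih => exact Prod.ext rfl ((congrArg _ (M.d_one n 0)).trans ih)
  · induction n with
    | zero => rintro (_ | i) h x <;> rfl
    | succ n ih =>
      rintro (_ | i) h x
      · rfl
      · exact Prod.ext rfl
          ((congrArg _ (M.d_d n 0 (i+1) (by omega) (by omega) x)).trans (ih i (by omega) _))
  · induction n with
    | zero =>
      intro i h x
      obtain rfl : i = 0 := by omega
      exact Prod.ext rfl (M.d_s_self 0 0 h x)
    | succ n ih =>
      rintro (_ | i) h x
      · exact Prod.ext rfl (congrArg (Wiota M.toSMonData (n+1)) (M.d_s_self (n+1) 0 h x))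
      · exact Prod.ext rfl
          ((congrArg _ (M.d_s_lt n 0 (i+1) (by omega) (by omega) x)).trans (ih i (by omega) _))

theorem isSMonMor_Wmu (M : SMonData.{u}) :
    IsSMonMor (WmonData (WmonData M)) (WmonData M) (Wmu M) := by
  refine isSMonMor_Wmap ?_ ?_ ?_ ?_
  · rintro (_ | n) x y <;> rfl
  · rintro (_ | n) <;> rfl
  · rintro (_ | n) i h x <;> rfl
  · rintro (_ | n) (_ | i) h x
    · rfl
    · omega
    · rfl
    · rfl

theorem Wmap_Wiota {M N : SMonData.{u}} {f : ∀ n, M.X n → N.X n} (hf : IsSMonMor M N f) :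
    ∀ n (m : M.X n), Wmap M N f n (Wiota M n m) = Wiota N n (f n m)
  | 0, _ => rfl
  | n+1, m => Prod.ext rfl
      ((Wmap_Wiota hf n _).trans (congrArg _ (hf.2.2.1 n 0 (Nat.zero_le _) m)))

theorem Wmap_Wmu (M N : SMonData.{u}) (f : ∀ n, M.X n → N.X n) :
    ∀ n (x : WObj (WmonData M) n), Wmap M N f n (Wmu M n x) =
      Wmu N n (Wmap (WmonData M) (WmonData N) (Wmap M N f) n x)
  | 0, _ => rfl
  | n+1, x => Prod.ext rfl (Wmap_Wmu M N f n x.2)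

theorem Wmu_Wmap_Wiota (M : SMonData.{u}) :
    ∀ n (x : WObj M n), Wmu M n (Wmap M (WmonData M) (Wiota M) n x) = x
  | 0, _ => rfl
  | n+1, x => Prod.ext rfl (Wmu_Wmap_Wiota M n x.2)

theorem Wmu_Wiota (M : SMonData.{u}) :
    ∀ n (x : WObj M n), Wmu M n (Wiota (WmonData M) n x) = x
  | 0, _ => rfl
  | n+1, x => Prod.ext rfl ((congrArg (fun y => Wmu M n (Wiota (WmonData M) n y))
      (Wd_zero M n x)).trans (Wmu_Wiota M n x.2))

theorem Wmu_assoc (M : SMonData.{u}) : ∀ n (x : WObj (WmonData (WmonData M)) n),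
    Wmu M n (Wmap (WmonData (WmonData M)) (WmonData M) (Wmu M) n x) =
      Wmu M n (Wmu (WmonData M) n x)
  | 0, _ => rfl
  | n+1, x => Prod.ext rfl (Wmu_assoc M n x.2)

/-- For every simplicial monoid `M`, the data `W_mon M` (componentwise monoid
structure, with the faces/degeneracies `Wd`/`Ws` above) is a simplicial monoid, and the
assignment `M ↦ W_mon M`, together with the unit `ι_M : m ↦ (m, d_0 m, …, d_0ⁿ m)` and the
multiplication `μ_M` given levelwise by the product of first-factor projections, is a monad
on the category of simplicial monoids. -/
theorem Wmon_monad :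
    -- `W_mon M` is a simplicial monoid
    (∀ M : SMon.{u}, IsSimplicialMonoid (WmonData M.toSMonData) ∧
      ∃ H : SMon.{u}, H.toSMonData = WmonData M.toSMonData) ∧
    -- functoriality
    (∀ (M N : SMon.{u}) (f : ∀ n, M.X n → N.X n),
      IsSMonMor M.toSMonData N.toSMonData f →
        IsSMonMor (WmonData M.toSMonData) (WmonData N.toSMonData)
          (Wmap M.toSMonData N.toSMonData f)) ∧
    (∀ (M : SMon.{u}) (n : ℕ) (x : WObj M.toSMonData n),
      Wmap M.toSMonData M.toSMonData (fun _ m => m) n x = x) ∧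
    (∀ (M N P : SMon.{u}) (f : ∀ n, M.X n → N.X n) (g : ∀ n, N.X n → P.X n),
      IsSMonMor M.toSMonData N.toSMonData f → IsSMonMor N.toSMonData P.toSMonData g →
        ∀ n x, Wmap M.toSMonData P.toSMonData (fun m y => g m (f m y)) n x =
          Wmap N.toSMonData P.toSMonData g n (Wmap M.toSMonData N.toSMonData f n x)) ∧
    -- `ι` and `μ` are morphisms of simplicial monoids
    (∀ M : SMon.{u}, IsSMonMor M.toSMonData (WmonData M.toSMonData) (Wiota M.toSMonData)) ∧
    (∀ M : SMon.{u}, IsSMonMor (WmonData (WmonData M.toSMonData)) (WmonData M.toSMonData)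
      (Wmu M.toSMonData)) ∧
    -- naturality of `ι` and `μ`
    (∀ (M N : SMon.{u}) (f : ∀ n, M.X n → N.X n),
      IsSMonMor M.toSMonData N.toSMonData f →
        (∀ n (m : M.X n),
          Wmap M.toSMonData N.toSMonData f n (Wiota M.toSMonData n m) =
            Wiota N.toSMonData n (f n m)) ∧
        (∀ n (x : WObj (WmonData M.toSMonData) n),
          Wmap M.toSMonData N.toSMonData f n (Wmu M.toSMonData n x) =
            Wmu N.toSMonData n
              (Wmap (WmonData M.toSMonData) (WmonData N.toSMonData)
                (Wmap M.toSMonData N.toSMonData f) n x))) ∧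
    -- unit laws
    (∀ (M : SMon.{u}) (n : ℕ) (x : WObj M.toSMonData n),
      Wmu M.toSMonData n
        (Wmap M.toSMonData (WmonData M.toSMonData) (Wiota M.toSMonData) n x) = x) ∧
    (∀ (M : SMon.{u}) (n : ℕ) (x : WObj M.toSMonData n),
      Wmu M.toSMonData n (Wiota (WmonData M.toSMonData) n x) = x) ∧
    -- associativity
    (∀ (M : SMon.{u}) (n : ℕ) (x : WObj (WmonData (WmonData M.toSMonData)) n),
      Wmu M.toSMonData n
        (Wmap (WmonData (WmonData M.toSMonData)) (WmonData M.toSMonData)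
          (Wmu M.toSMonData) n x) =
      Wmu M.toSMonData n (Wmu (WmonData M.toSMonData) n x)) := by
  exact ⟨fun M => ⟨isSimplicialMonoid_WmonData M,
      (isSimplicialMonoid_WmonData M).exists_toSMonData_eq⟩,
    fun _ _ _ ⟨hmul, hone, hd, hs⟩ =>
      isSMonMor_Wmap hmul hone (fun n i hi => hd n (i+1) (by omega)) hs,
    fun M => Wmap_id M.toSMonData,
    fun M N P f g _ _ => Wmap_comp M.toSMonData N.toSMonData P.toSMonData f g,
    isSMonMor_Wiota,
    fun M => isSMonMor_Wmu M.toSMonData,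
    fun M N f hf => ⟨Wmap_Wiota hf, Wmap_Wmu M.toSMonData N.toSMonData f⟩,
    fun M => Wmu_Wmap_Wiota M.toSMonData,
    fun M => Wmu_Wiota M.toSMonData,
    fun M => Wmu_assoc M.toSMonData⟩
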